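/- Let A be a skew Boolean ∩-algebra, let P ⊆ A be a prime ideal, and let x, y ∈ A with x ≤ y in the natural partial order. Then x ∈ P if and only if y θ_P (y∖x). -/

import Mathlib

universe u

/-- A skew Boolean ∩-algebra. -/
class SkewBooleanInterAlgebra (α : Type u) where
  meet : α → α → α
  join : α → α → α
  zero : α
  rcomp : α → α → α
  inter : α → α → α
  meet_idem : ∀ x, meet x x = x
  meet_assoc : ∀ x y z, meet (meet x y) z = meet x (meet y z)
  join_idem : ∀ x, join x x = x
  join_assoc : ∀ x y z, join (join x y) z = join x (join y z)
  absorb₁ : ∀ x y, meet x (join x y) = x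
  absorb₂ : ∀ x y, meet (join y x) x = x
  absorb₃ : ∀ x y, join x (meet x y) = x
  absorb₄ : ∀ x y, join (meet y x) x = x
  meet_distrib_left : ∀ x y z, meet x (join y z) = join (meet x y) (meet x z)
  meet_distrib_right : ∀ x y z, meet (join y z) x = join (meet y x) (meet z x)
  zero_join : ∀ x, join zero x = x
  join_zero : ∀ x, join x zero = x
  rcomp_meet : ∀ x y, meet (rcomp x y) (meet x (meet y x)) = zero
  rcomp_join : ∀ x y, join (rcomp x y) (meet x (meet y x)) = x
  normality : ∀ x y z w, meet x (meet y (meet z w)) = meet x (meet z (meet y w))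
  regularity : ∀ x y z, join x (join y (join x (join z x))) = join x (join y (join z x))
  inter_le_left : ∀ x y, meet (inter x y) x = inter x y ∧ meet x (inter x y) = inter x y
  inter_le_right : ∀ x y, meet (inter x y) y = inter x y ∧ meet y (inter x y) = inter x y
  inter_glb : ∀ x y z, (meet z x = z ∧ meet x z = z) → (meet z y = z ∧ meet y z = z) →
    meet z (inter x y) = z ∧ meet (inter x y) z = z

namespace SkewBooleanInterAlgebra

variable {α : Type u} [SkewBooleanInterAlgebra α]

/-- The natural partial order: `x ≤ y` iff `x∧y = x = y∧x`. -/
def nle (x y : α) : Prop := meet x y = x ∧ meet y x = x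

/-- The natural preorder: `x ≼ y` iff `x∧y∧x = x`. -/
def npre (x y : α) : Prop := meet x (meet y x) = x

/-- Green's relation `D`: `x D y` iff `x ≼ y` and `y ≼ x`. -/
def dGreen (x y : α) : Prop := npre x y ∧ npre y x

/-- An ideal: contains `0`, closed under `∨`, downward closed under `≼`. -/
def IsIdeal (I : Set α) : Prop :=
  zero ∈ I ∧ (∀ x ∈ I, ∀ y ∈ I, join x y ∈ I) ∧ (∀ x y : α, y ∈ I → npre x y → x ∈ I)

/-- A prime ideal: a proper ideal such that `a∧b ∈ P` implies `a ∈ P` or `b ∈ P`. -/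
def IsPrimeIdeal (P : Set α) : Prop :=
  IsIdeal P ∧ P ≠ Set.univ ∧ ∀ a b : α, meet a b ∈ P → a ∈ P ∨ b ∈ P

/-- The congruence `θ_P` associated with an ideal `P`. -/
def theta (P : Set α) (x y : α) : Prop :=
  join (rcomp x (inter x y)) (rcomp y (inter x y)) ∈ P

end SkewBooleanInterAlgebra

namespace SkewBooleanInterAlgebra

variable {α : Type u} [SkewBooleanInterAlgebra α]

theorem zero_meet (x : α) : meet zero x = (zero : α) := by
  simpa only [zero_join] using absorb₁ (zero : α) x

theorem meet_zero (x : α) : meet x zero = (zero : α) := by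
  simpa only [join_zero] using absorb₂ (zero : α) x

theorem meet_eq_zero_symm {x y : α} (h : meet x y = zero) : meet y x = zero := by
  rw [← meet_idem (meet y x), meet_assoc, ← meet_assoc x, h, zero_meet, meet_zero]

theorem nle.meet_meet_eq {x y : α} (h : nle x y) : meet y (meet x y) = x := by
  rw [h.1, h.2]

theorem rcomp_meet_of_nle {x y : α} (h : nle x y) : meet (rcomp y x) x = zero := by
  simpa only [h.meet_meet_eq] using rcomp_meet y x

theorem rcomp_join_of_nle {x y : α} (h : nle x y) : join (rcomp y x) x = y := by
  simpa only [h.meet_meet_eq] using rcomp_join y x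

theorem rcomp_nle_of_nle {x y : α} (h : nle x y) : nle (rcomp y x) y := by
  constructor
  · simpa only [rcomp_join_of_nle h] using absorb₁ (rcomp y x) x
  · have := meet_distrib_right (rcomp y x) (rcomp y x) x
    rwa [rcomp_join_of_nle h, meet_idem, meet_eq_zero_symm (rcomp_meet_of_nle h),
      join_zero] at this

theorem inter_eq_right_of_nle {x y : α} (h : nle x y) : inter y x = x :=
  (inter_le_right y x).2.symm.trans
    (inter_glb y x x h ⟨meet_idem x, meet_idem x⟩).1

theorem rcomp_self (x : α) : rcomp x x = zero := by
  have h : nle x x := ⟨meet_idem x, meet_idem x⟩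
  exact (rcomp_nle_of_nle h).1.symm.trans (rcomp_meet_of_nle h)

theorem npre_of_meet_eq {u w : α} (h : meet u w = u) : npre u w := by
  rw [npre, ← meet_assoc, h, meet_idem]

theorem dGreen_rcomp_rcomp {x y : α} (h : nle x y) : dGreen (rcomp y (rcomp y x)) x := by
  have hz := rcomp_nle_of_nle h
  constructor
  · have hw := meet_distrib_left (rcomp y (rcomp y x)) (rcomp y x) x
    rw [rcomp_join_of_nle h, (rcomp_nle_of_nle hz).1, rcomp_meet_of_nle hz, zero_join] at hw
    exact npre_of_meet_eq hw.symm
  · have hx := meet_distrib_left x (rcomp y (rcomp y x)) (rcomp y x)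
    rw [rcomp_join_of_nle hz, h.1, meet_eq_zero_symm (rcomp_meet_of_nle h), join_zero] at hx
    exact npre_of_meet_eq hx.symm

theorem theta_iff_rcomp_mem_of_nle {P : Set α} {z y : α} (h : nle z y) :
    theta P y z ↔ rcomp y z ∈ P := by
  rw [theta, inter_eq_right_of_nle h, rcomp_self, join_zero]

end SkewBooleanInterAlgebra

open SkewBooleanInterAlgebra

theorem mem_iff_theta_rcomp {α : Type u} [SkewBooleanInterAlgebra α]
    (P : Set α) (hP : IsPrimeIdeal P) (x y : α) (hxy : nle x y) :
    x ∈ P ↔ theta P y (rcomp y x) := by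
  obtain ⟨⟨-, -, hdown⟩, -⟩ := hP
  obtain ⟨h₁, h₂⟩ := dGreen_rcomp_rcomp hxy
  rw [theta_iff_rcomp_mem_of_nle (rcomp_nle_of_nle hxy)]
  exact ⟨fun hx => hdown _ _ hx h₁, fun hw => hdown _ _ hw h₂⟩
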